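/- arXiv:2010.16001 — 7 statements merged into one kernel-verified Lean document; each statement's English description precedes it below -/
import Mathlib

section
/- Let C = {x ∈ ℝⁿ : h(x) ≥ 0} be the 0-superlevel set of a continuously differentiable function h : ℝⁿ → ℝ for which 0 is a regular value (h(x) = 0 implies Dh(x) ≠ 0). Let f : ℝⁿ → ℝⁿ and g : ℝⁿ → ℝ^{n×m} be locally Lipschitz, let α : ℝ → ℝ be extended class K∞, and let k : ℝⁿ → ℝᵐ be a locally Lipschitz controller satisfying L_f h(x) + L_g h(x)·k(x) ≥ −α(h(x)) for all x ∈ C. Then C is forward invariant for the closed-loop system: for every T ∈ (0, ∞] and every curve x : [0, T) → ℝⁿ that is differentiable with x′(t) = f(x(t)) + g(x(t))·k(x(t)) for all t ∈ [0, T) and satisfies h(x(0)) ≥ 0, one has h(x(t)) ≥ 0 for all t ∈ [0, T). -/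
open scoped ENNReal

/-- A function `α : ℝ → ℝ` is of extended class `K∞`: continuous, strictly increasing,
`α 0 = 0`, `α r → ∞` as `r → ∞`, and `α r → -∞` as `r → -∞`. -/
def ExtendedClassKInf (α : ℝ → ℝ) : Prop :=
  Continuous α ∧ StrictMono α ∧ α 0 = 0 ∧
    Filter.Tendsto α Filter.atTop Filter.atTop ∧
    Filter.Tendsto α Filter.atBot Filter.atBot

open Filter Topology Set in
lemma cbf_aux_tangent {E : Type*} [NormedAddCommGroup E] [NormedSpace ℝ E]
    (h : E → ℝ) (hh : ContDiff ℝ 1 h) (hreg : ∀ x, h x = 0 → fderiv ℝ h x ≠ 0)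
    (y w : E) (hy : 0 ≤ h y) (hw : h y = 0 → 0 ≤ fderiv ℝ h y w) :
    ∃ v : E, ∀ η : ℝ, 0 < η → ∀ᶠ s in 𝓝[>] (0:ℝ), 0 ≤ h (y + s • (w + η • v)) := by
  rcases hy.lt_or_eq with hpos | hzero
  · refine ⟨0, fun η _ => ?_⟩
    have hc : Continuous fun s : ℝ => h (y + s • (w + η • (0:E))) := by
      have := hh.continuous
      fun_prop
    have h0 : 0 < h (y + (0:ℝ) • (w + η • (0:E))) := by simpa using hpos
    have := (hc.tendsto 0).eventually (lt_mem_nhds h0)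
    exact (this.filter_mono nhdsWithin_le_nhds).mono fun s hs => hs.le
  · obtain ⟨v, hv⟩ : ∃ v, 0 < fderiv ℝ h y v := by
      obtain ⟨v, hv⟩ := DFunLike.ne_iff.1 (hreg y hzero.symm)
      rcases lt_or_gt_of_ne hv with hv | hv
      · exact ⟨-v, by simpa using hv⟩
      · exact ⟨v, by simpa using hv⟩
    refine ⟨v, fun η hη => ?_⟩
    have hpos : 0 < fderiv ℝ h y (w + η • v) := by
      have := hw hzero.symm
      rw [map_add, map_smul, smul_eq_mul]
      positivity
    have hd : HasDerivAt (fun s : ℝ => h (y + s • (w + η • v))) (fderiv ℝ h y (w + η • v)) 0 := by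
      have h1 : HasFDerivAt h (fderiv ℝ h y) (y + (0:ℝ) • (w + η • v)) := by
        simpa using (hh.differentiable (by norm_num) y).hasFDerivAt
      have h2 : HasDerivAt (fun s : ℝ => y + s • (w + η • v)) (w + η • v) 0 := by
        simpa using ((hasDerivAt_id (0:ℝ)).smul_const (w + η • v)).const_add y
      exact h1.comp_hasDerivAt 0 h2
    have := (hasDerivAt_iff_tendsto_slope.1 hd).eventually (lt_mem_nhds hpos)
    have := this.filter_mono (nhdsWithin_mono (0:ℝ) (t := {0}ᶜ) (s := Ioi 0)
      (fun x hx => (ne_of_gt hx : x ≠ 0)))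
    filter_upwards [this, self_mem_nhdsWithin] with s hs hs0
    have hs0 : 0 < s := hs0
    simp only [slope_def_field, zero_smul, add_zero, ← hzero, sub_zero] at hs
    exact ((div_pos_iff_of_pos_right hs0).1 hs).le

open Filter Topology Set in
lemma cbf_aux_main {E : Type*} [NormedAddCommGroup E] [NormedSpace ℝ E] [FiniteDimensional ℝ E]
    (h : E → ℝ) (hh : ContDiff ℝ 1 h) (hreg : ∀ x, h x = 0 → fderiv ℝ h x ≠ 0)
    (F : E → E) (hF : LocallyLipschitz F)
    (hb : ∀ x, h x = 0 → 0 ≤ fderiv ℝ h x (F x))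
    (φ : ℝ → E) (T : ℝ) (hT : 0 ≤ T) (hφ : ∀ t ∈ Icc 0 T, HasDerivAt φ (F (φ t)) t)
    (h0 : 0 ≤ h (φ 0)) : 0 ≤ h (φ T) := by
  have : ProperSpace E := FiniteDimensional.proper ℝ E
  set C : Set E := {x | 0 ≤ h x} with hC
  have hCc : IsClosed C := isClosed_le continuous_const hh.continuous
  have h0C : φ 0 ∈ C := h0
  have hCn : C.Nonempty := ⟨φ 0, h0C⟩
  have hcont : ContinuousOn φ (Icc 0 T) := fun t ht => (hφ t ht).continuousAt.continuousWithinAt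
  obtain ⟨R, hR⟩ : ∃ R, ∀ t ∈ Icc 0 T, dist (φ t) (φ 0) ≤ R := by
    obtain ⟨R, hR⟩ := ((isCompact_Icc.image_of_continuousOn hcont).isBounded).subset_closedBall (φ 0)
    exact ⟨R, fun t ht => hR (mem_image_of_mem φ ht)⟩
  obtain ⟨L, hL⟩ := (hF.locallyLipschitzOn (s := Metric.closedBall (φ 0) (R + R))).exists_lipschitzOnWith_of_compact
    (isCompact_closedBall _ _)
  have hR0 : 0 ≤ R := by simpa using hR 0 ⟨le_rfl, hT⟩
  have key := le_gronwallBound_of_liminf_deriv_right_le (f := fun t => Metric.infDist (φ t) C)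
    (f' := fun t => L * Metric.infDist (φ t) C) (δ := 0) (K := L) (ε := 0) (a := 0) (b := T)
    ((Metric.continuous_infDist_pt C).comp_continuousOn hcont) ?_ 
    (Metric.infDist_zero_of_mem h0C).le (fun t _ => by simp) T ⟨hT, le_rfl⟩
  · rw [gronwallBound_ε0_δ0] at key
    exact (hCc.mem_iff_infDist_zero hCn).2 (le_antisymm key Metric.infDist_nonneg)
  intro t ht r hr
  have ht' : t ∈ Icc 0 T := Ico_subset_Icc_self ht
  obtain ⟨y, hyC, hyd⟩ := hCc.exists_infDist_eq_dist hCn (φ t)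
  simp only [hyd] at hr ⊢
  have hball : dist (F (φ t)) (F y) ≤ L * dist (φ t) y := by
    have h1 : dist (φ t) y ≤ R := by
      rw [← hyd]; exact (Metric.infDist_le_dist_of_mem h0C).trans (hR t ht')
    refine hL.dist_le_mul _ ?_ _ ?_
    · exact Metric.mem_closedBall.2 ((hR t ht').trans (by linarith))
    · have := dist_triangle_left y (φ 0) (φ t)
      exact Metric.mem_closedBall.2 (this.trans (add_le_add h1 (hR t ht')))
  obtain ⟨v, hv⟩ := cbf_aux_tangent h hh hreg y (F y) hyC (hb y)
  obtain ⟨η, hη, hηr⟩ : ∃ η : ℝ, 0 < η ∧ η * (1 + ‖v‖) < r - L * dist (φ t) y := by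
    have h1 : 0 < 1 + ‖v‖ := by positivity
    refine ⟨(r - L * dist (φ t) y) / 2 / (1 + ‖v‖), by have := sub_pos.2 hr; positivity, ?_⟩
    rw [div_mul_cancel₀ _ h1.ne']
    linarith
  have e1 : ∀ᶠ z in 𝓝[>] t, 0 ≤ h (y + (z - t) • (F y + η • v)) := by
    have : Tendsto (fun z => z - t) (𝓝[>] t) (𝓝[>] 0) := by
      refine tendsto_nhdsWithin_iff.2 ⟨?_, ?_⟩
      · have : Tendsto (fun z => z - t) (𝓝 t) (𝓝 (t - t)) := (continuous_sub_right t).tendsto t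
        rw [sub_self] at this
        exact this.mono_left nhdsWithin_le_nhds
      · filter_upwards [self_mem_nhdsWithin] with z hz
        exact sub_pos.2 (mem_Ioi.1 hz)
    exact this.eventually (hv η hη)
  have e2 : ∀ᶠ z in 𝓝[>] t, ‖φ z - φ t - (z - t) • F (φ t)‖ ≤ η * ‖z - t‖ :=
    ((hasDerivAt_iff_isLittleO.1 (hφ t ht')).def hη).filter_mono nhdsWithin_le_nhds
  refine Eventually.frequently ?_
  filter_upwards [e1, e2, self_mem_nhdsWithin] with z hz1 hz2 hz
  have hs : 0 < z - t := sub_pos.2 hz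
  have hle : Metric.infDist (φ z) C ≤ ‖φ z - (y + (z - t) • (F y + η • v))‖ := by
    rw [← dist_eq_norm]; exact Metric.infDist_le_dist_of_mem (show _ ∈ C from hz1)
  have hdec : φ z - (y + (z - t) • (F y + η • v)) = (φ z - φ t - (z - t) • F (φ t)) + (φ t - y)
      + (z - t) • (F (φ t) - F y) - (z - t) • (η • v) := by
    simp only [smul_add, smul_sub]; abel
  have hn : ‖φ z - (y + (z - t) • (F y + η • v))‖ ≤ ‖φ z - φ t - (z - t) • F (φ t)‖ + ‖φ t - y‖
      + ‖(z - t) • (F (φ t) - F y)‖ + ‖(z - t) • (η • v)‖ := by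
    rw [hdec]
    exact (norm_sub_le _ _).trans (by gcongr; exact norm_add₃_le)
  rw [norm_smul, norm_smul, norm_smul, Real.norm_of_nonneg hs.le, Real.norm_of_nonneg hη.le,
    ← dist_eq_norm (φ t) y, ← dist_eq_norm (F (φ t))] at hn
  rw [Real.norm_of_nonneg hs.le] at hz2
  rw [inv_mul_lt_iff₀ hs]
  have h3 := mul_le_mul_of_nonneg_left hball hs.le
  have h4 := mul_lt_mul_of_pos_left hηr hs
  linarith

lemma cbf_aux_lip {E U : Type*} [NormedAddCommGroup E] [NormedSpace ℝ E]
    [NormedAddCommGroup U] [NormedSpace ℝ U] (f : E → E) (g : E → U →L[ℝ] E) (k : E → U)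
    (hf : LocallyLipschitz f) (hg : LocallyLipschitz g) (hk : LocallyLipschitz k) :
    LocallyLipschitz fun x => f x + g x (k x) := by
  have hB : ContDiff ℝ 1 (fun p : E × (U →L[ℝ] E) × U => p.1 + p.2.1 p.2.2) := by
    fun_prop
  have h2 := hB.locallyLipschitz
  have h3 : LocallyLipschitz (fun x => (f x, g x, k x)) := hf.prodMk (hg.prodMk hk)
  exact h2.comp h3

/-- Theorem 1 (CBF safety): if `h` is a CBF with `0` a regular value and the locally
Lipschitz controller `k` satisfies the CBF inequality on `C = {x | h x ≥ 0}`, then `C` is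
forward invariant for the closed-loop system `ẋ = f(x) + g(x) k(x)`. -/
theorem cbf_safety (n m : ℕ)
    (h : EuclideanSpace ℝ (Fin n) → ℝ)
    (f : EuclideanSpace ℝ (Fin n) → EuclideanSpace ℝ (Fin n))
    (g : EuclideanSpace ℝ (Fin n) → EuclideanSpace ℝ (Fin m) →L[ℝ] EuclideanSpace ℝ (Fin n))
    (α : ℝ → ℝ)
    (k : EuclideanSpace ℝ (Fin n) → EuclideanSpace ℝ (Fin m))
    (hh : ContDiff ℝ 1 h)
    (hreg : ∀ x, h x = 0 → fderiv ℝ h x ≠ 0)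
    (hf : LocallyLipschitz f) (hg : LocallyLipschitz g) (hk : LocallyLipschitz k)
    (hα : ExtendedClassKInf α)
    (hcbf : ∀ x, 0 ≤ h x →
      fderiv ℝ h x (f x) + fderiv ℝ h x (g x (k x)) ≥ - α (h x)) :
    ∀ T : ℝ≥0∞, 0 < T →
      ∀ φ : ℝ → EuclideanSpace ℝ (Fin n),
        (∀ t : ℝ, 0 ≤ t → ENNReal.ofReal t < T →
          HasDerivAt φ (f (φ t) + g (φ t) (k (φ t))) t) →
        0 ≤ h (φ 0) →
        ∀ t : ℝ, 0 ≤ t → ENNReal.ofReal t < T → 0 ≤ h (φ t) := by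
  obtain ⟨_, _, hα0, _, _⟩ := hα
  intro T _ φ hφ h0 t ht htT
  have hF : LocallyLipschitz fun x => f x + g x (k x) := cbf_aux_lip f g k hf hg hk
  refine cbf_aux_main h hh hreg _ hF (fun x hx => ?_) φ t ht (fun s hs => hφ s hs.1
    ((ENNReal.ofReal_le_ofReal hs.2).trans_lt htT)) h0
  have := hcbf x hx.ge
  rw [hx, hα0, neg_zero] at this
  rw [map_add]
  exact this
end

section
/- Let C = {x ∈ ℝⁿ : h(x) ≥ 0} be the 0-superlevel set of a continuously differentiable function h : ℝⁿ → ℝ for which 0 is a regular value. Let f : ℝⁿ → ℝⁿ and g : ℝⁿ → ℝ^{n×m} be locally Lipschitz, and let α : ℝ → ℝ be extended class K∞. Assume the functions L_f h : ℝⁿ → ℝ, L_g h : ℝⁿ → ℝᵐ, and α∘h : ℝⁿ → ℝ are Lipschitz continuous with Lipschitz constants 𝔏_F, 𝔏_G, 𝔏_A respectively. Let p : ℝⁿ → ℝᵏ (measurement map) and q̂ : ℝᵏ → ℝⁿ (state-estimate map) be locally Lipschitz, and let ε : ℝᵏ → ℝ≥0 be locally Lipschitz and satisfy ‖q̂(p(x))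 − x‖ ≤ ε(p(x)) for all x ∈ C. Let k : ℝᵏ × ℝⁿ → ℝᵐ be a locally Lipschitz controller such that for every x ∈ C, writing y = p(x) and x̂ = q̂(y), it holds that L_f h(x̂) + L_g h(x̂)·k(y, x̂) − ε(y)(𝔏_F + 𝔏_A) − ε(y) 𝔏_G ‖k(y, x̂)‖ ≥ −α(h(x̂)). Then C is forward invariant for the closed-loop system: for every T ∈ (0, ∞] and every differentiable curve x : [0, T) → ℝⁿ with x′(t) = f(x(t)) + g(x(t))·k(p(x(t)), q̂(p(x(t)))) for all t ∈ [0, T) and h(x(0)) ≥ 0, one has h(x(t)) ≥ 0 for all t ∈ [0, T). -/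
open scoped ENNReal

/-- The Lie derivative `L_f h(x) = Dh(x) f(x)`. -/
noncomputable def LieF {n : ℕ} (h : EuclideanSpace ℝ (Fin n) → ℝ)
    (f : EuclideanSpace ℝ (Fin n) → EuclideanSpace ℝ (Fin n))
    (x : EuclideanSpace ℝ (Fin n)) : ℝ :=
  fderiv ℝ h x (f x)

/-- The Lie derivative `L_g h(x) = Dh(x) g(x)`, a linear functional on `ℝᵐ`. -/
noncomputable def LieG {n m : ℕ} (h : EuclideanSpace ℝ (Fin n) → ℝ)
    (g : EuclideanSpace ℝ (Fin n) → EuclideanSpace ℝ (Fin m) →L[ℝ] EuclideanSpace ℝ (Fin n))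
    (x : EuclideanSpace ℝ (Fin n)) : EuclideanSpace ℝ (Fin m) →L[ℝ] ℝ :=
  (fderiv ℝ h x).comp (g x)

open Filter Topology in
lemma mr_aux_local {E : Type*} [NormedAddCommGroup E] [NormedSpace ℝ E] (h G : E → ℝ)
    (hh : ContDiff ℝ 1 h) (hG : LocallyLipschitz G) (hpos : ∀ x, 0 ≤ h x → 0 ≤ G x)
    (x0 : E) (h0 : h x0 = 0) (hreg : fderiv ℝ h x0 ≠ 0) :
    ∃ L : ℝ, ∀ᶠ x in 𝓝 x0, h x ≤ 0 → L * h x ≤ G x := by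
  obtain ⟨w, hw⟩ : ∃ w, fderiv ℝ h x0 w ≠ 0 := by
    by_contra! hcon
    exact hreg (by ext w; simpa using hcon w)
  set v : E := (2 / fderiv ℝ h x0 w) • w with hv
  have hDv : fderiv ℝ h x0 v = 2 := by
    rw [hv, map_smul, smul_eq_mul]; field_simp
  have hstrict : HasStrictFDerivAt h (fderiv ℝ h x0) x0 :=
    hh.contDiffAt.hasStrictFDerivAt (by norm_num)
  obtain ⟨K, t, ht, hK⟩ := hG x0
  have hc : (0:ℝ) < 1 / (‖v‖ + 1) := by positivity
  have hb := hstrict.isLittleO.bound hc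
  have hcont : Continuous (fun x => x + (- h x) • v) := by
    have := hh.continuous
    fun_prop
  have htend : Tendsto (fun x => x + (- h x) • v) (𝓝 x0) (𝓝 x0) := by
    have := hcont.tendsto x0
    simpa [h0] using this
  have htend2 : Tendsto (fun x => (x + (- h x) • v, x)) (𝓝 x0) (𝓝 (x0, x0)) := by
    rw [nhds_prod_eq]
    exact htend.prodMk tendsto_id
  refine ⟨K * ‖v‖, ?_⟩
  filter_upwards [htend2.eventually hb, htend.eventually ht, ht] with x hx1 hx2 hx3 hneg
  have hn : ‖(- h x) • v‖ = (- h x) * ‖v‖ := by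
    rw [norm_smul, Real.norm_of_nonneg (by linarith)]
  simp only [add_sub_cancel_left, map_smul, hDv, hn, smul_eq_mul] at hx1
  have hle : 1 / (‖v‖ + 1) * (- h x * ‖v‖) ≤ - h x := by
    have : 1 / (‖v‖ + 1) * ‖v‖ ≤ 1 := by
      rw [div_mul_eq_mul_div, div_le_one (by positivity)]; linarith
    nlinarith
  have h1 := (abs_le.mp (Real.norm_eq_abs _ ▸ hx1)).1
  have h2 : 0 ≤ h (x + (- h x) • v) := by linarith
  have h3 := hpos _ h2
  have h4 := hK.dist_le_mul _ hx2 _ hx3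
  rw [Real.dist_eq, dist_eq_norm, add_sub_cancel_left, hn] at h4
  have h5 := (abs_le.mp h4).2
  nlinarith

open Filter Topology in
lemma mr_aux_ode (η η' : ℝ → ℝ) (t1 : ℝ) (ht1 : 0 ≤ t1)
    (hd : ∀ t, 0 ≤ t → t ≤ t1 → HasDerivAt η (η' t) t) (h0 : 0 ≤ η 0)
    (hloc : ∀ t, 0 ≤ t → t ≤ t1 → η t = 0 →
      ∃ L : ℝ, ∀ᶠ s in 𝓝 t, η s ≤ 0 → L * η s ≤ η' s) : 0 ≤ η t1 := by
  by_contra! hneg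
  have hcont : ContinuousOn η (Set.Icc 0 t1) := fun t ht =>
    (hd t ht.1 ht.2).continuousAt.continuousWithinAt
  set S : Set ℝ := Set.Icc 0 t1 ∩ η ⁻¹' (Set.Ici 0) with hS
  have hSc : IsCompact S :=
    isCompact_Icc.of_isClosed_subset
      (hcont.preimage_isClosed_of_isClosed isClosed_Icc isClosed_Ici) Set.inter_subset_left
  obtain ⟨t0, ht0, hmax⟩ := hSc.exists_isGreatest ⟨0, ⟨le_refl _, ht1⟩, h0⟩
  have hη0 : 0 ≤ η t0 := ht0.2
  have hlt : t0 < t1 := lt_of_le_of_ne ht0.1.2 (by rintro rfl; linarith)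
  have hafter : ∀ s, t0 < s → s ≤ t1 → η s < 0 := by
    intro s hs hs1
    by_contra! hc
    exact absurd (hmax ⟨⟨ht0.1.1.trans hs.le, hs1⟩, hc⟩) (not_le.mpr hs)
  have hz : η t0 = 0 := by
    apply le_antisymm _ hη0
    have hct := (hd t0 ht0.1.1 ht0.1.2).continuousAt.tendsto
    refine le_of_tendsto (hct.mono_left (nhdsWithin_le_nhds (s := Set.Ioi t0))) ?_
    filter_upwards [Ioc_mem_nhdsGT hlt] with s hs
    exact (hafter s hs.1 hs.2).le
  obtain ⟨L, hL⟩ := hloc t0 ht0.1.1 ht0.1.2 hz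
  obtain ⟨δ, hδ, hball⟩ := Metric.eventually_nhds_iff.mp hL
  set t2 := min t1 (t0 + δ / 2) with ht2
  have h02 : t0 < t2 := lt_min hlt (by linarith)
  have h21 : t2 ≤ t1 := min_le_left _ _
  have h2δ : t2 ≤ t0 + δ / 2 := min_le_right _ _
  have hder : ∀ s, t0 ≤ s → s ≤ t2 → HasDerivAt (fun s => η s * Real.exp (-L * s))
      (η' s * Real.exp (-L * s) + η s * (Real.exp (-L * s) * (-L * 1))) s := by
    intro s hs hs2
    exact (hd s (ht0.1.1.trans hs) (hs2.trans h21)).mul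
      (((hasDerivAt_id s).const_mul (-L)).exp)
  have hmono : MonotoneOn (fun s => η s * Real.exp (-L * s)) (Set.Icc t0 t2) := by
    apply monotoneOn_of_deriv_nonneg (convex_Icc _ _)
    · exact fun s hs => (hder s hs.1 hs.2).continuousAt.continuousWithinAt
    · intro s hs
      rw [interior_Icc] at hs
      exact (hder s hs.1.le hs.2.le).differentiableAt.differentiableWithinAt
    · intro s hs
      rw [interior_Icc] at hs
      rw [(hder s hs.1.le hs.2.le).deriv]
      have h1 := hball (y := s) (by
        rw [Real.dist_eq, abs_lt]; constructor <;> linarith [hs.1, hs.2])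
        (hafter s hs.1 (hs.2.le.trans h21)).le
      have := Real.exp_pos (-L * s)
      nlinarith
  have hfin := hmono ⟨le_refl _, h02.le⟩ ⟨h02.le, le_refl _⟩ h02.le
  simp only [hz, zero_mul] at hfin
  have := hafter t2 h02 h21
  have := Real.exp_pos (-L * t2)
  nlinarith

set_option maxHeartbeats 2000000 in
/-- Theorem 2 (MR-CBF safety): a locally Lipschitz controller satisfying the
Measurement-Robust CBF condition with parameter function
`(ε(y)(𝔏_F + 𝔏_A), ε(y) 𝔏_G)` renders `C = {x | h x ≥ 0}` forward invariant for the
closed-loop system `ẋ = f(x) + g(x) k(p(x), q̂(p(x)))`. -/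
theorem mr_cbf_safety (n m κ : ℕ)
    (h : EuclideanSpace ℝ (Fin n) → ℝ)
    (f : EuclideanSpace ℝ (Fin n) → EuclideanSpace ℝ (Fin n))
    (g : EuclideanSpace ℝ (Fin n) → EuclideanSpace ℝ (Fin m) →L[ℝ] EuclideanSpace ℝ (Fin n))
    (α : ℝ → ℝ) (𝔏F 𝔏G 𝔏A : ℝ)
    (p : EuclideanSpace ℝ (Fin n) → EuclideanSpace ℝ (Fin κ))
    (qhat : EuclideanSpace ℝ (Fin κ) → EuclideanSpace ℝ (Fin n))
    (ε : EuclideanSpace ℝ (Fin κ) → ℝ)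
    (k : EuclideanSpace ℝ (Fin κ) × EuclideanSpace ℝ (Fin n) → EuclideanSpace ℝ (Fin m))
    (hh : ContDiff ℝ 1 h)
    (hreg : ∀ x, h x = 0 → fderiv ℝ h x ≠ 0)
    (hf : LocallyLipschitz f) (hg : LocallyLipschitz g)
    (hα : ExtendedClassKInf α)
    (hLF : ∀ x x', |LieF h f x - LieF h f x'| ≤ 𝔏F * ‖x - x'‖)
    (hLG : ∀ x x', ‖LieG h g x - LieG h g x'‖ ≤ 𝔏G * ‖x - x'‖)
    (hLA : ∀ x x', |α (h x) - α (h x')| ≤ 𝔏A * ‖x - x'‖)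
    (hp : LocallyLipschitz p) (hq : LocallyLipschitz qhat)
    (hεnn : ∀ y, 0 ≤ ε y) (hεlip : LocallyLipschitz ε)
    (herr : ∀ x, 0 ≤ h x → ‖qhat (p x) - x‖ ≤ ε (p x))
    (hk : LocallyLipschitz k)
    (hmrcbf : ∀ x, 0 ≤ h x →
      LieF h f (qhat (p x)) + LieG h g (qhat (p x)) (k (p x, qhat (p x)))
        - ε (p x) * (𝔏F + 𝔏A) - ε (p x) * 𝔏G * ‖k (p x, qhat (p x))‖
        ≥ - α (h (qhat (p x)))) :
    ∀ T : ℝ≥0∞, 0 < T →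
      ∀ φ : ℝ → EuclideanSpace ℝ (Fin n),
        (∀ t : ℝ, 0 ≤ t → ENNReal.ofReal t < T →
          HasDerivAt φ (f (φ t) + g (φ t) (k (p (φ t), qhat (p (φ t))))) t) →
        0 ≤ h (φ 0) →
        ∀ t : ℝ, 0 ≤ t → ENNReal.ofReal t < T → 0 ≤ h (φ t) := by
  intro T hT φ hφ h0 t1 ht1 ht1T
  obtain ⟨hαc, hαm, hα0, -, -⟩ := hα
  rcases Nat.eq_zero_or_pos n with hn | hn
  · subst hn
    rwa [Subsingleton.elim (φ t1) (φ 0)]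
  obtain ⟨z, hz⟩ : ∃ z : EuclideanSpace ℝ (Fin n), ‖z‖ = 1 :=
    ⟨EuclideanSpace.single ⟨0, hn⟩ 1, by simp⟩
  have hF0 : 0 ≤ 𝔏F := by
    have := (abs_nonneg _).trans (hLF z 0); simpa [hz] using this
  have hG0 : 0 ≤ 𝔏G := by
    have := (norm_nonneg _).trans (hLG z 0); simpa [hz] using this
  have hA0 : 0 ≤ 𝔏A := by
    have := (abs_nonneg _).trans (hLA z 0); simpa [hz] using this
  have lF : LocallyLipschitz (LieF h f) :=
    (LipschitzWith.of_dist_le' (K := 𝔏F) fun x y => by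
      rw [Real.dist_eq, dist_eq_norm]; exact hLF x y).locallyLipschitz
  have lG : LocallyLipschitz (LieG h g) :=
    (LipschitzWith.of_dist_le' (K := 𝔏G) fun x y => by
      rw [dist_eq_norm, dist_eq_norm]; exact hLG x y).locallyLipschitz
  have lA : LocallyLipschitz (fun x => α (h x)) :=
    (LipschitzWith.of_dist_le' (K := 𝔏A) fun x y => by
      rw [Real.dist_eq, dist_eq_norm]; exact hLA x y).locallyLipschitz
  have lk : LocallyLipschitz (fun x => k (p x, qhat (p x))) :=
    hk.comp (hp.prodMk (hq.comp hp))
  have lGk : LocallyLipschitz (fun x => LieG h g x (k (p x, qhat (p x)))) :=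
    (ContDiff.locallyLipschitz (𝕂 := ℝ)
      (isBoundedBilinearMap_apply (𝕜 := ℝ) (E := EuclideanSpace ℝ (Fin m)) (F := ℝ)).contDiff).comp
      (lG.prodMk lk)
  have lTot : LocallyLipschitz
      (fun x => LieF h f x + LieG h g x (k (p x, qhat (p x))) + α (h x)) :=
    (lF.add lGk).add lA
  have hpos : ∀ x, 0 ≤ h x →
      0 ≤ LieF h f x + LieG h g x (k (p x, qhat (p x))) + α (h x) := by
    intro x hx
    have e := herr x hx
    have c := hmrcbf x hx
    set u := k (p x, qhat (p x))
    have a1 := (abs_le.mp (hLF (qhat (p x)) x)).2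
    have a2 := (abs_le.mp (hLA (qhat (p x)) x)).2
    have a3 := (LieG h g (qhat (p x)) - LieG h g x).le_opNorm u
    have a4 := mul_le_mul_of_nonneg_right (hLG (qhat (p x)) x) (norm_nonneg u)
    have a5 := (le_abs_self _).trans ((Real.norm_eq_abs _).symm.le.trans (a3.trans a4))
    rw [ContinuousLinearMap.sub_apply] at a5
    have b1 := mul_le_mul_of_nonneg_left e hF0
    have b2 := mul_le_mul_of_nonneg_left e hA0
    have b3 := mul_le_mul_of_nonneg_right (mul_le_mul_of_nonneg_left e hG0) (norm_nonneg u)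
    nlinarith
  have hT' : ∀ t, t ≤ t1 → ENNReal.ofReal t < T := fun t ht =>
    (ENNReal.ofReal_le_ofReal ht).trans_lt ht1T
  refine mr_aux_ode (fun t => h (φ t))
    (fun t => LieF h f (φ t) + LieG h g (φ t) (k (p (φ t), qhat (p (φ t))))) t1 ht1 ?_ h0 ?_
  · intro t ht htt
    have hd := ((hh.differentiable (by norm_num)) (φ t)).hasFDerivAt.comp_hasDerivAt t
      (hφ t ht (hT' t htt))
    rw [map_add] at hd
    exact hd
  · intro t ht htt hzero
    obtain ⟨L, hL⟩ := mr_aux_local h _ hh lTot hpos (φ t) hzero (hreg _ hzero)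
    refine ⟨L, ?_⟩
    filter_upwards [(hφ t ht (hT' t htt)).continuousAt.eventually hL] with s hs hle
    have h1 := hs hle
    have h2 : α (h (φ s)) ≤ 0 := hα0 ▸ hαm.monotone hle
    linarith
end

section
/- Let C = {x ∈ ℝⁿ : h(x) ≥ 0} be the 0-superlevel set of a continuously differentiable function h : ℝⁿ → ℝ, let f : ℝⁿ → ℝⁿ and g : ℝⁿ → ℝ^{n×m} be locally Lipschitz, and let α : ℝ → ℝ be extended class K∞. Assume L_f h, L_g h, and α∘h are Lipschitz continuous with Lipschitz constants 𝔏_F, 𝔏_G, 𝔏_A respectively, where 𝔏_G > 0 and 𝔏_F + 𝔏_A > 0. Let p : ℝⁿ → ℝᵏ and q̂ : ℝᵏ → ℝⁿ be locally Lipschitz with ‖q̂(p(x)) − x‖ ≤ ε(p(x)) for all x ∈ C, where ε : ℝᵏ → ℝ≥0. Suppose that for all x ∈ C: ε(p(x)) < max{ ‖L_g h(x)‖ / (2 𝔏_G), (L_f h(x) + α(h(x))) / (2(𝔏_F + 𝔏_A)) }. Then for every x ∈ C, writing y = p(x) and x̂ = q̂(y), there exists u ∈ ℝᵐ such that L_f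 h(x̂) + L_g h(x̂)·u − ε(y)(𝔏_F + 𝔏_A + 𝔏_G ‖u‖) > −α(h(x̂)); that is, h is an MR-CBF for the system on C with parameter function (ε(y)(𝔏_F + 𝔏_A), ε(y)𝔏_G). -/
/-- Theorem 3: if the measurement error bound satisfies
`ε(p(x)) < max{‖L_g h(x)‖/(2𝔏_G), (L_f h(x)+α(h(x)))/(2(𝔏_F+𝔏_A))}` for all `x ∈ C`, then
`h` is an MR-CBF on `C` with parameter function `(ε(y)(𝔏_F+𝔏_A), ε(y)𝔏_G)`: at every
measurement-estimate pair coming from `C` some input `u` satisfies the strict MR-CBF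
inequality. -/
theorem mr_cbf_from_error_bound (n m κ : ℕ)
    (h : EuclideanSpace ℝ (Fin n) → ℝ)
    (f : EuclideanSpace ℝ (Fin n) → EuclideanSpace ℝ (Fin n))
    (g : EuclideanSpace ℝ (Fin n) → EuclideanSpace ℝ (Fin m) →L[ℝ] EuclideanSpace ℝ (Fin n))
    (α : ℝ → ℝ) (𝔏F 𝔏G 𝔏A : ℝ)
    (p : EuclideanSpace ℝ (Fin n) → EuclideanSpace ℝ (Fin κ))
    (qhat : EuclideanSpace ℝ (Fin κ) → EuclideanSpace ℝ (Fin n))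
    (ε : EuclideanSpace ℝ (Fin κ) → ℝ)
    (hh : ContDiff ℝ 1 h)
    (hf : LocallyLipschitz f) (hg : LocallyLipschitz g)
    (hα : ExtendedClassKInf α)
    (hLF : ∀ x x', |LieF h f x - LieF h f x'| ≤ 𝔏F * ‖x - x'‖)
    (hLG : ∀ x x', ‖LieG h g x - LieG h g x'‖ ≤ 𝔏G * ‖x - x'‖)
    (hLA : ∀ x x', |α (h x) - α (h x')| ≤ 𝔏A * ‖x - x'‖)
    (hLGpos : 0 < 𝔏G) (hLFApos : 0 < 𝔏F + 𝔏A)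
    (hp : LocallyLipschitz p) (hq : LocallyLipschitz qhat)
    (hεnn : ∀ y, 0 ≤ ε y)
    (herr : ∀ x, 0 ≤ h x → ‖qhat (p x) - x‖ ≤ ε (p x))
    (hbound : ∀ x, 0 ≤ h x →
      ε (p x) < max (‖LieG h g x‖ / (2 * 𝔏G))
        ((LieF h f x + α (h x)) / (2 * (𝔏F + 𝔏A)))) :
    ∀ x, 0 ≤ h x →
      ∃ u : EuclideanSpace ℝ (Fin m),
        LieF h f (qhat (p x)) + LieG h g (qhat (p x)) u
          - ε (p x) * (𝔏F + 𝔏A + 𝔏G * ‖u‖) > - α (h (qhat (p x))) := by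
  intro x hx
  have he := herr x hx
  have hb := hbound x hx
  have h0 := hεnn (p x)
  generalize ε (p x) = e at *
  generalize qhat (p x) = z at *
  have h1 := (abs_le.1 (hLF z x)).1
  have h2 := (abs_le.1 (hLA z x)).1
  have h3 := hLG x z
  rw [norm_sub_rev x z] at h3
  have h4 := norm_sub_norm_le (LieG h g x) (LieG h g z)
  have h5 : 𝔏G * ‖z - x‖ ≤ 𝔏G * e := mul_le_mul_of_nonneg_left he hLGpos.le
  have h6 : (𝔏F + 𝔏A) * ‖z - x‖ ≤ (𝔏F + 𝔏A) * e := mul_le_mul_of_nonneg_left he hLFApos.le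
  rcases lt_max_iff.1 hb with hc | hc
  · rw [lt_div_iff₀ (by positivity)] at hc
    have h7 : e * 𝔏G < ‖LieG h g z‖ := by linarith
    have h8 : ∃ v, e * 𝔏G * ‖v‖ < LieG h g z v := by
      by_contra! hcon
      refine absurd ((LieG h g z).opNorm_le_bound (by positivity) (fun v => ?_)) (not_le.2 h7)
      rw [Real.norm_eq_abs, abs_le]
      have h9 := hcon (-v)
      rw [norm_neg, map_neg] at h9
      exact ⟨by linarith, hcon v⟩
    obtain ⟨v, hv⟩ := h8
    have hd : 0 < LieG h g z v - e * 𝔏G * ‖v‖ := by linarith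
    obtain ⟨k, hk⟩ := Archimedean.arch
      (e * (𝔏F + 𝔏A) - LieF h f z - α (h z) + 1) hd
    refine ⟨(k : ℝ) • v, ?_⟩
    rw [map_smul, norm_smul, smul_eq_mul, Real.norm_natCast]
    rw [nsmul_eq_mul] at hk
    linarith
  · rw [lt_div_iff₀ (by positivity)] at hc
    refine ⟨0, ?_⟩
    rw [map_zero, norm_zero]
    linarith
end

section
/- Let C = {x ∈ ℝⁿ : h(x) ≥ 0} be the 0-superlevel set of a continuously differentiable function h : ℝⁿ → ℝ, let f : ℝⁿ → ℝⁿ and g : ℝⁿ → ℝ^{n×m} be locally Lipschitz, and let α : ℝ → ℝ be extended class K∞. Assume L_f h, L_g h, and α∘h are Lipschitz continuous with Lipschitz constants 𝔏_F, 𝔏_G, 𝔏_A, where 𝔏_G > 0 and 𝔏_F + 𝔏_A > 0. Let p : ℝⁿ → ℝᵏ and q̂ : ℝᵏ → ℝⁿ be locally Lipschitz. Let S be a finite set of training states in ℝⁿ, let L, σ, γ ≥ 0, and for x ∈ ℝⁿ set N(x) = #{xᵢ ∈ S : ‖x − xᵢ‖ ≤ γ} and M(x) = max{ ‖L_g h(x)‖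 / 𝔏_G, (L_f h(x) + α(h(x))) / (𝔏_F + 𝔏_A) }. Suppose that for all x ∈ C: N(x) ≥ 1, ‖q̂(p(x)) − x‖ ≤ Lγ + σ / √(N(x)) (the nonparametric error bound), M(x) > 2Lγ, and N(x) > 4σ² / (M(x) − 2Lγ)². Then for every x ∈ C, writing y = p(x) and x̂ = q̂(y), there exists u ∈ ℝᵐ such that L_f h(x̂) + L_g h(x̂)·u − (Lγ + σ/√(N(x)))·(𝔏_F + 𝔏_A + 𝔏_G ‖u‖) > −α(h(x̂)). -/
open scoped Classical

/-- The number of training points of `S` within distance `γ` of `x`. -/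
noncomputable def trainCount {n : ℕ} (S : Finset (EuclideanSpace ℝ (Fin n))) (γ : ℝ)
    (x : EuclideanSpace ℝ (Fin n)) : ℕ :=
  (S.filter fun xi => ‖x - xi‖ ≤ γ).card

/-- The maximum admissible error
`M(x) = max{‖L_g h(x)‖/𝔏_G, (L_f h(x)+α(h(x)))/(𝔏_F+𝔏_A)}`. -/
noncomputable def admissibleErr {n m : ℕ} (h : EuclideanSpace ℝ (Fin n) → ℝ)
    (f : EuclideanSpace ℝ (Fin n) → EuclideanSpace ℝ (Fin n))
    (g : EuclideanSpace ℝ (Fin n) → EuclideanSpace ℝ (Fin m) →L[ℝ] EuclideanSpace ℝ (Fin n))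
    (α : ℝ → ℝ) (𝔏F 𝔏G 𝔏A : ℝ) (x : EuclideanSpace ℝ (Fin n)) : ℝ :=
  max (‖LieG h g x‖ / 𝔏G) ((LieF h f x + α (h x)) / (𝔏F + 𝔏A))

/-- Corollary 1: if the learned estimate `q̂` satisfies the `(L, σ)` nonparametric error
bound with hyperparameter `γ` and the training data is dense enough relative to the
maximum admissible error `M(x)`, then the strict MR-CBF inequality is feasible at every
measurement-estimate pair coming from `C`. -/
theorem mr_cbf_from_nonparametric_bound (n m κ : ℕ)
    (h : EuclideanSpace ℝ (Fin n) → ℝ)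
    (f : EuclideanSpace ℝ (Fin n) → EuclideanSpace ℝ (Fin n))
    (g : EuclideanSpace ℝ (Fin n) → EuclideanSpace ℝ (Fin m) →L[ℝ] EuclideanSpace ℝ (Fin n))
    (α : ℝ → ℝ) (𝔏F 𝔏G 𝔏A : ℝ)
    (p : EuclideanSpace ℝ (Fin n) → EuclideanSpace ℝ (Fin κ))
    (qhat : EuclideanSpace ℝ (Fin κ) → EuclideanSpace ℝ (Fin n))
    (S : Finset (EuclideanSpace ℝ (Fin n))) (L σ γ : ℝ)
    (hh : ContDiff ℝ 1 h)
    (hf : LocallyLipschitz f) (hg : LocallyLipschitz g)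
    (hα : ExtendedClassKInf α)
    (hLF : ∀ x x', |LieF h f x - LieF h f x'| ≤ 𝔏F * ‖x - x'‖)
    (hLG : ∀ x x', ‖LieG h g x - LieG h g x'‖ ≤ 𝔏G * ‖x - x'‖)
    (hLA : ∀ x x', |α (h x) - α (h x')| ≤ 𝔏A * ‖x - x'‖)
    (hLGpos : 0 < 𝔏G) (hLFApos : 0 < 𝔏F + 𝔏A)
    (hp : LocallyLipschitz p) (hq : LocallyLipschitz qhat)
    (hL : 0 ≤ L) (hσ : 0 ≤ σ) (hγ : 0 ≤ γ)
    (hNpos : ∀ x, 0 ≤ h x → 1 ≤ trainCount S γ x)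
    (herr : ∀ x, 0 ≤ h x →
      ‖qhat (p x) - x‖ ≤ L * γ + σ / Real.sqrt (trainCount S γ x))
    (hM : ∀ x, 0 ≤ h x → admissibleErr h f g α 𝔏F 𝔏G 𝔏A x > 2 * L * γ)
    (hdense : ∀ x, 0 ≤ h x →
      (trainCount S γ x : ℝ) >
        4 * σ ^ 2 / (admissibleErr h f g α 𝔏F 𝔏G 𝔏A x - 2 * L * γ) ^ 2) :
    ∀ x, 0 ≤ h x →
      ∃ u : EuclideanSpace ℝ (Fin m),
        LieF h f (qhat (p x)) + LieG h g (qhat (p x)) u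
          - (L * γ + σ / Real.sqrt (trainCount S γ x)) * (𝔏F + 𝔏A + 𝔏G * ‖u‖)
          > - α (h (qhat (p x))) := by
  intro x hx
  have hN : (1:ℝ) ≤ trainCount S γ x := by exact_mod_cast hNpos x hx
  have he := herr x hx
  have hm := hM x hx
  have hd := hdense x hx
  generalize (trainCount S γ x : ℝ) = N at *
  have hsp : 0 < Real.sqrt N := Real.sqrt_pos.mpr (by linarith)
  have hsq : Real.sqrt N ^ 2 = N := Real.sq_sqrt (by linarith)
  have h2 : 2 * (L * γ + σ / Real.sqrt N) < admissibleErr h f g α 𝔏F 𝔏G 𝔏A x := by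
    have hpos : 0 < admissibleErr h f g α 𝔏F 𝔏G 𝔏A x - 2 * L * γ := by linarith
    rw [gt_iff_lt, div_lt_iff₀ (by positivity)] at hd
    have h4 : 2 * σ < Real.sqrt N * (admissibleErr h f g α 𝔏F 𝔏G 𝔏A x - 2 * L * γ) := by
      refine lt_of_pow_lt_pow_left₀ 2 (by positivity) ?_
      rw [mul_pow, mul_pow, hsq]
      linarith
    have h5 : 2 * σ / Real.sqrt N < admissibleErr h f g α 𝔏F 𝔏G 𝔏A x - 2 * L * γ := by
      rw [div_lt_iff₀ hsp]
      linarith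
    rw [mul_div_assoc] at h5
    linarith
  generalize L * γ + σ / Real.sqrt N = ε at *
  generalize qhat (p x) = z at *
  have hF := (abs_le.mp (hLF z x)).1
  have hA := (abs_le.mp (hLA z x)).1
  have hmul : (𝔏F + 𝔏A) * ‖z - x‖ ≤ (𝔏F + 𝔏A) * ε := mul_le_mul_of_nonneg_left he hLFApos.le
  rcases lt_max_iff.mp h2 with h3 | h3
  · rw [lt_div_iff₀ hLGpos] at h3
    have hG := hLG x z
    rw [norm_sub_rev x z] at hG
    have hGm : 𝔏G * ‖z - x‖ ≤ 𝔏G * ε := mul_le_mul_of_nonneg_left he hLGpos.le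
    have htri := norm_le_norm_add_norm_sub' (LieG h g x) (LieG h g z)
    have hε : 0 ≤ ε := (norm_nonneg _).trans he
    have hex : ∃ v, ε * 𝔏G * ‖v‖ < LieG h g z v := by
      by_contra! hcon
      have hb : ‖LieG h g z‖ ≤ ε * 𝔏G := by
        refine ContinuousLinearMap.opNorm_le_bound _ (by positivity) fun v => ?_
        rw [Real.norm_eq_abs, abs_le]
        have h5 := hcon (-v)
        rw [map_neg, norm_neg] at h5
        exact ⟨by linarith, hcon v⟩
      linarith
    obtain ⟨v, hv⟩ := hex
    set δ := LieG h g z v - ε * 𝔏G * ‖v‖ with hδ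
    have hδp : 0 < δ := by linarith
    set K := |LieF h f z + α (h z) - ε * (𝔏F + 𝔏A)| with hK
    have hKn := neg_abs_le (LieF h f z + α (h z) - ε * (𝔏F + 𝔏A))
    rw [← hK] at hKn
    have ht : 0 ≤ (K + 1) / δ := by positivity
    refine ⟨((K + 1) / δ) • v, ?_⟩
    have hc : (K + 1) / δ * δ = K + 1 := div_mul_cancel₀ _ hδp.ne'
    rw [map_smul, norm_smul, Real.norm_of_nonneg ht, smul_eq_mul]
    generalize (K + 1) / δ = t at *
    rw [hδ] at hc
    linarith
  · rw [lt_div_iff₀ hLFApos] at h3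
    refine ⟨0, ?_⟩
    simp only [map_zero, norm_zero, mul_zero, add_zero]
    linarith
end

section
/- Let c ∈ ℝᵐ, F, A ∈ ℝ, L₁, L₂ > 0, and ε ≥ 0. Then there exists u ∈ ℝᵐ such that F + ⟨c, u⟩ − ε(L₁ + L₂‖u‖) > −A if and only if ε < max{ ‖c‖ / L₂, (F + A) / L₁ }. -/
open scoped RealInnerProductSpace

/-- Feasibility characterization of the strict MR-CBF condition at a fixed
measurement-estimate pair: an input `u` with
`F + ⟨c, u⟩ − ε(L₁ + L₂‖u‖) > −A` exists iff `ε < max{‖c‖/L₂, (F + A)/L₁}`. -/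
theorem mr_cbf_feasibility_iff (m : ℕ) (c : EuclideanSpace ℝ (Fin m))
    (F A L₁ L₂ ε : ℝ) (hL₁ : 0 < L₁) (hL₂ : 0 < L₂) (hε : 0 ≤ ε) :
    (∃ u : EuclideanSpace ℝ (Fin m),
        F + ⟪c, u⟫ - ε * (L₁ + L₂ * ‖u‖) > - A) ↔
      ε < max (‖c‖ / L₂) ((F + A) / L₁) := by
  rw [lt_max_iff, lt_div_iff₀ hL₂, lt_div_iff₀ hL₁]
  constructor
  · rintro ⟨u, hu⟩
    by_contra! h
    obtain ⟨h1, h2⟩ := h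
    have h3 := real_inner_le_norm c u
    have h4 := mul_le_mul_of_nonneg_right h1 (norm_nonneg u)
    nlinarith
  · rintro (h | h)
    · have hc : 0 < ‖c‖ := lt_of_le_of_lt (by positivity) h
      have hD : 0 < ‖c‖ * (‖c‖ - ε * L₂) := mul_pos hc (by linarith)
      obtain ⟨t, ht⟩ : ∃ t, t = (|F + A - ε * L₁| + 1) / (‖c‖ * (‖c‖ - ε * L₂)) := ⟨_, rfl⟩
      have ht0 : 0 ≤ t := by rw [ht]; positivity
      have htD : t * (‖c‖ * (‖c‖ - ε * L₂)) = |F + A - ε * L₁| + 1 := by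
        rw [ht]; exact div_mul_cancel₀ _ hD.ne'
      refine ⟨t • c, ?_⟩
      rw [real_inner_smul_right, real_inner_self_eq_norm_sq, norm_smul, Real.norm_of_nonneg ht0]
      have := neg_abs_le (F + A - ε * L₁)
      nlinarith
    · refine ⟨0, ?_⟩
      rw [inner_zero_right, norm_zero]
      linarith
end

section
/- Let a, b, d₁, d₂, L, ε ∈ ℝ with b ≥ 0, ε ≥ 0, bε < |a|, Lε ≤ d₂, and ε(2L|a| + b(d₂ − d₁)) ≤ |a|(d₁ + d₂). Then there exists u ∈ ℝ such that a·u − bε|u| ≥ −d₁ + Lε and −a·u − bε|u| ≥ −d₂ + Lε. -/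
/-- Sufficiency case of the simultaneous feasibility lemma (Lemma E.1): under the stated
conditions on `a, b, d₁, d₂, L, ε`, the two scalar MR-CBF constraints are simultaneously
feasible for some input `u`. -/
theorem simultaneous_feasibility (a b d₁ d₂ L ε : ℝ)
    (hb : 0 ≤ b) (hε : 0 ≤ ε)
    (h1 : b * ε < |a|) (h2 : L * ε ≤ d₂)
    (h3 : ε * (2 * L * |a| + b * (d₂ - d₁)) ≤ |a| * (d₁ + d₂)) :
    ∃ u : ℝ, a * u - b * ε * |u| ≥ -d₁ + L * ε ∧
      -(a * u) - b * ε * |u| ≥ -d₂ + L * ε := by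
  have hbe : 0 ≤ b * ε := mul_nonneg hb hε
  have hS : 0 < |a| + b * ε := by linarith
  obtain ⟨t, ht⟩ : ∃ t, t = (d₂ - L * ε) / (|a| + b * ε) := ⟨_, rfl⟩
  have ht0 : 0 ≤ t := by
    rw [ht]
    exact div_nonneg (by linarith) hS.le
  have hmul : t * (|a| + b * ε) = d₂ - L * ε := by
    rw [ht]
    exact div_mul_cancel₀ _ hS.ne'
  have key : -d₁ + L * ε ≤ |a| * t - b * ε * t := by
    refine le_of_mul_le_mul_right ?_ hS
    have e : (|a| * t - b * ε * t) * (|a| + b * ε) = (|a| - b * ε) * (d₂ - L * ε) := by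
      rw [← hmul]
      ring
    rw [e]
    nlinarith [h3]
  rcases le_total 0 a with ha | ha
  · rw [abs_of_nonneg ha] at key hmul
    refine ⟨t, ?_, ?_⟩ <;> rw [abs_of_nonneg ht0] <;> linarith
  · rw [abs_of_nonpos ha] at key hmul
    refine ⟨-t, ?_, ?_⟩ <;> rw [abs_neg, abs_of_nonneg ht0] <;> linarith
end

section
/- Let a, b, ε, L, d₂ ∈ ℝ with b ≥ 0, ε ≥ 0, bε ≤ |a|, a ≠ 0, and Lε ≤ d₂. Then for every u ∈ ℝ satisfying −a·u − bε|u| ≥ −d₂ + Lε, one has a·u − bε|u| ≤ (|a| − bε)(d₂ − Lε)/(|a| + bε); moreover u* = sign(a)·(d₂ − Lε)/(|a| + bε) satisfies the constraint −a·u* − bε|u*| ≥ −d₂ + Lε and attains a·u* − bε|u*| = (|a| − bε)(d₂ − Lε)/(|a| + bε). -/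
/-- One-dimensional constrained optimization from the proof of Lemma E.1: subject to
`−au − bε|u| ≥ −d₂ + Lε`, the objective `au − bε|u|` is at most
`(|a| − bε)(d₂ − Lε)/(|a| + bε)`, and this value is attained at
`u* = sign(a)(d₂ − Lε)/(|a| + bε)`, which is feasible. -/
theorem one_dim_constrained_max (a b ε L d₂ : ℝ)
    (hb : 0 ≤ b) (hε : 0 ≤ ε) (hba : b * ε ≤ |a|) (ha : a ≠ 0)
    (hLd : L * ε ≤ d₂) :
    (∀ u : ℝ, -(a * u) - b * ε * |u| ≥ -d₂ + L * ε →
      a * u - b * ε * |u| ≤ (|a| - b * ε) * (d₂ - L * ε) / (|a| + b * ε)) ∧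
    (-(a * (Real.sign a * (d₂ - L * ε) / (|a| + b * ε)))
        - b * ε * |Real.sign a * (d₂ - L * ε) / (|a| + b * ε)| ≥ -d₂ + L * ε) ∧
    (a * (Real.sign a * (d₂ - L * ε) / (|a| + b * ε))
        - b * ε * |Real.sign a * (d₂ - L * ε) / (|a| + b * ε)|
        = (|a| - b * ε) * (d₂ - L * ε) / (|a| + b * ε)) := by
  have hc : 0 ≤ b * ε := mul_nonneg hb hε
  have hA : 0 < |a| := abs_pos.mpr ha
  have hs : 0 < |a| + b * ε := by linarith
  have ht : 0 ≤ (d₂ - L * ε) / (|a| + b * ε) := div_nonneg (by linarith) hs.le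
  have htD : (d₂ - L * ε) / (|a| + b * ε) * (|a| + b * ε) = d₂ - L * ε :=
    div_mul_cancel₀ _ hs.ne'
  have h1 : a * (Real.sign a * (d₂ - L * ε) / (|a| + b * ε))
      = |a| * ((d₂ - L * ε) / (|a| + b * ε)) := by
    rcases lt_or_gt_of_ne ha with h | h
    · rw [Real.sign_of_neg h, abs_of_neg h]; ring
    · rw [Real.sign_of_pos h, abs_of_pos h]; ring
  have h2 : |Real.sign a * (d₂ - L * ε) / (|a| + b * ε)|
      = (d₂ - L * ε) / (|a| + b * ε) := by
    rw [mul_div_assoc, abs_mul, abs_of_nonneg ht]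
    rcases lt_or_gt_of_ne ha with h | h
    · rw [Real.sign_of_neg h]; simp
    · rw [Real.sign_of_pos h]; simp
  refine ⟨?_, ?_, ?_⟩
  · intro u hu
    rw [le_div_iff₀ hs]
    have h3 : a * u ≤ |a| * |u| := by rw [← abs_mul]; exact le_abs_self _
    have h4 : 0 ≤ (|a| - b * ε) * ((d₂ - L * ε) - (a * u + b * ε * |u|)) :=
      mul_nonneg (by linarith) (by linarith)
    have h5 : 0 ≤ (b * ε) * (|a| * |u| - a * u) := mul_nonneg hc (by linarith)
    linarith
  · rw [h1, h2]
    linarith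
  · rw [h1, h2, mul_div_assoc]
    ring
end
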